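/- arXiv:2405.13302 — 2 statements merged into one kernel-verified Lean document; each statement's English description precedes it below -/
import Mathlib

section
/- Let (X, d) be a metric space in which the distance between any two distinct points is a positive integer, and let x, y ∈ X satisfy d(x, y) = 1. Let μ_x and μ_y be finitely supported probability measures on X with μ_x supported on {z : d(z, x) = 1} and μ_y supported on {z : d(z, y) = 1}. Suppose that A := 1 − μ_x(y) − μ_y(x) − Σ_{z : d(z,x)=1, d(z,y)=1} max(μ_x(z), μ_y(z)) ≥ 0. Then W₁(μ_x, μ_y) ≤ 3 − 2 μ_x(y) − 2 μ_y(x) − Σ_{z : d(z,x)=1, d(z,y)=1} max(μ_x(z), μ_y(z)) − 2 Σ_{z : d(z,x)=1, d(z,y)=1} min(μ_x(z), μ_y(z)). -/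
open scoped Classical

/-- Wasserstein distance between finitely supported mass functions `μ ν : X → ℝ`,
defined as the infimum of total transport cost over all finitely supported couplings. -/
noncomputable def W1 {X : Type*} (d : X → X → ℝ) (μ ν : X → ℝ) : ℝ :=
  sInf { c : ℝ | ∃ γ : (X × X) →₀ ℝ,
    (∀ p, 0 ≤ γ p) ∧
    (∀ u : X, (∑ᶠ v : X, γ (u, v)) = μ u) ∧
    (∀ v : X, (∑ᶠ u : X, γ (u, v)) = ν v) ∧
    c = ∑ᶠ p : X × X, d p.1 p.2 * γ p }

/-- `μ : X → ℝ` is a finitely supported probability mass function. -/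
def IsFinProb {X : Type*} (μ : X → ℝ) : Prop :=
  (∀ z, 0 ≤ μ z) ∧ (Function.support μ).Finite ∧ (∑ᶠ z, μ z) = 1

/-- A coupling concentrated on a finite square bounds the Wasserstein distance from above. -/
theorem W1_le_sum_of_coupling {X : Type*} {d : X → X → ℝ} (hd : ∀ u v, 0 ≤ d u v)
    {μ ν : X → ℝ} (T : Finset X) (γ : X → X → ℝ) (hγ : ∀ u v, 0 ≤ γ u v)
    (hT : ∀ u v, γ u v ≠ 0 → u ∈ T ∧ v ∈ T)
    (hfst : ∀ u, ∑ v ∈ T, γ u v = μ u) (hsnd : ∀ v, ∑ u ∈ T, γ u v = ν v) :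
    W1 d μ ν ≤ ∑ u ∈ T, ∑ v ∈ T, d u v * γ u v := by
  apply csInf_le
  · refine ⟨0, ?_⟩
    rintro c ⟨γ', h0, -, -, rfl⟩
    exact finsum_nonneg fun p => mul_nonneg (hd _ _) (h0 p)
  · refine ⟨Finsupp.onFinset (T ×ˢ T) (fun p => γ p.1 p.2)
      (fun p hp => Finset.mem_product.2 (hT _ _ hp)), fun p => hγ _ _, fun u => ?_, fun v => ?_, ?_⟩
    · simp only [Finsupp.onFinset_apply]
      rw [← hfst u]
      exact finsum_eq_sum_of_support_subset _ fun v hv => (hT u v hv).2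
    · simp only [Finsupp.onFinset_apply]
      rw [← hsnd v]
      exact finsum_eq_sum_of_support_subset _ fun u hu => (hT u v hu).1
    · simp only [Finsupp.onFinset_apply]
      rw [← Finset.sum_product' T T fun u v => d u v * γ u v]
      refine (finsum_eq_sum_of_support_subset _ fun p hp => ?_).symm
      exact Finset.mem_coe.2 (Finset.mem_product.2 (hT _ _ (right_ne_zero_of_mul hp)))

/-- Transport cost of the plan that keeps `m` fixed, sends `f` to `q`, sends part of `p` to `g`, and
sends the remaining mass `A` of `p` to `q`. The weights `f'` and `g'` bound the cost per unit of `q`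
and of `p` respectively. -/
theorem W1_le_of_decomposition {X : Type*} [MetricSpace X] {μ ν : X → ℝ} (T : Finset X)
    (m f p g q f' g' : X → ℝ) (A K : ℝ)
    (hm : ∀ z, 0 ≤ m z) (hf : ∀ z, 0 ≤ f z) (hp : ∀ z, 0 ≤ p z) (hg : ∀ z, 0 ≤ g z)
    (hq : ∀ z, 0 ≤ q z) (hA : 0 ≤ A)
    (hmT : ∀ z ∉ T, m z = 0) (hfT : ∀ z ∉ T, f z = 0) (hpT : ∀ z ∉ T, p z = 0)
    (hgT : ∀ z ∉ T, g z = 0) (hqT : ∀ z ∉ T, q z = 0)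
    (hμ : ∀ z, μ z = m z + f z + p z) (hν : ∀ z, ν z = m z + g z + q z)
    (hP : ∑ z ∈ T, p z = A + ∑ z ∈ T, g z) (hQ : ∑ z ∈ T, q z = A + ∑ z ∈ T, f z)
    (hfq : ∀ u v, dist u v * (f u * q v) ≤ f' u * q v)
    (hpg : ∀ u v, dist u v * (p u * g v) ≤ p u * g' v)
    (hpq : ∀ u v, dist u v * (p u * q v) ≤ K * (p u * q v))
    (hf' : ∑ z ∈ T, q z = 0 → ∑ z ∈ T, f' z = 0)
    (hg' : ∑ z ∈ T, p z = 0 → ∑ z ∈ T, g' z = 0) :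
    W1 (fun u v => dist u v) μ ν ≤ ∑ z ∈ T, f' z + ∑ z ∈ T, g' z + K * A := by
  set P := ∑ z ∈ T, p z with hPdef
  set Q := ∑ z ∈ T, q z with hQdef
  set F := ∑ z ∈ T, f z with hFdef
  set G := ∑ z ∈ T, g z with hGdef
  have hP0 : 0 ≤ P := Finset.sum_nonneg fun z _ => hp z
  have hQ0 : 0 ≤ Q := Finset.sum_nonneg fun z _ => hq z
  have hF0 : 0 ≤ F := Finset.sum_nonneg fun z _ => hf z
  have hG0 : 0 ≤ G := Finset.sum_nonneg fun z _ => hg z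
  have vanish : ∀ h : X → ℝ, (∀ z, 0 ≤ h z) → (∀ z ∉ T, h z = 0) → ∑ z ∈ T, h z = 0 →
      ∀ z, h z = 0 := by
    intro h h0 hT hs z
    by_cases hz : z ∈ T
    · exact (Finset.sum_eq_zero_iff_of_nonneg fun z _ => h0 z).1 hs z hz
    · exact hT z hz
  let γ : X → X → ℝ := fun u v =>
    (if u = v then m u else 0) + f u * q v / Q + p u * g v / P + A * (p u * q v) / (P * Q)
  have hγ : ∀ u v, 0 ≤ γ u v := fun u v => by
    have := hm u; have := hf u; have := hp u; have := hg v; have := hq v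
    have : 0 ≤ if u = v then m u else 0 := by split_ifs <;> simp [hm]
    positivity
  have hT : ∀ u v, γ u v ≠ 0 → u ∈ T ∧ v ∈ T := by
    intro u v h
    refine ⟨?_, ?_⟩
    · by_contra hu
      exact h (by simp [γ, hmT u hu, hfT u hu, hpT u hu])
    · by_contra hv
      refine h ?_
      have : (if u = v then m u else 0) = 0 := by
        split_ifs with huv
        · rw [huv, hmT v hv]
        · rfl
      simp [γ, this, hgT v hv, hqT v hv]
  have hfst : ∀ u, ∑ v ∈ T, γ u v = μ u := by
    intro u
    have h1 : ∑ v ∈ T, (if u = v then m u else 0) = m u := by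
      rw [Finset.sum_ite_eq]
      split_ifs with hu
      · rfl
      · exact (hmT u hu).symm
    simp only [γ, Finset.sum_add_distrib, h1, ← Finset.sum_div, ← Finset.mul_sum]
    rw [← hQdef, ← hGdef, hμ u]
    rcases eq_or_ne Q 0 with hQz | hQz
    · have hA' : A = 0 := by linarith
      have hfu : f u = 0 := vanish f hf hfT (by linarith) u
      rcases eq_or_ne P 0 with hPz | hPz
      · simp [vanish p hp hpT hPz u, hfu]
      · have : G = P := by linarith
        simp [hA', hfu, this, hPz]
    · rcases eq_or_ne P 0 with hPz | hPz
      · simp [vanish p hp hpT hPz u, hQz]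
      · have : G = P - A := by linarith
        rw [this]
        field_simp
        ring
  have hsnd : ∀ v, ∑ u ∈ T, γ u v = ν v := by
    intro v
    have h1 : ∑ u ∈ T, (if u = v then m u else 0) = m v := by
      rw [Finset.sum_ite_eq']
      split_ifs with hv
      · rfl
      · exact (hmT v hv).symm
    simp only [γ, Finset.sum_add_distrib, h1, ← Finset.sum_div, ← Finset.mul_sum,
      ← Finset.sum_mul]
    rw [← hPdef, ← hFdef, hν v]
    rcases eq_or_ne P 0 with hPz | hPz
    · have hA' : A = 0 := by linarith
      have hgv : g v = 0 := vanish g hg hgT (by linarith) v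
      rcases eq_or_ne Q 0 with hQz | hQz
      · simp [vanish q hq hqT hQz v, hgv]
      · have : F = Q := by linarith
        simp [hA', hgv, this, hQz]
    · rcases eq_or_ne Q 0 with hQz | hQz
      · simp [vanish q hq hqT hQz v, hPz]
      · have : F = Q - A := by linarith
        rw [this]
        field_simp
        ring
  refine (W1_le_sum_of_coupling (fun _ _ => dist_nonneg) T γ hγ hT hfst hsnd).trans ?_
  have hcost : ∀ u v, dist u v * γ u v ≤
      f' u * q v / Q + p u * g' v / P + K * A * (p u * q v) / (P * Q) := by
    intro u v
    have h0 : dist u v * (if u = v then m u else 0) = 0 := by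
      split_ifs with huv <;> simp [huv]
    have h1 := div_le_div_of_nonneg_right (hfq u v) hQ0
    have h2 := div_le_div_of_nonneg_right (hpg u v) hP0
    have h3 := div_le_div_of_nonneg_right (mul_le_mul_of_nonneg_left (hpq u v) hA)
      (mul_nonneg hP0 hQ0)
    calc dist u v * γ u v
        = dist u v * (if u = v then m u else 0) + dist u v * (f u * q v) / Q
          + dist u v * (p u * g v) / P + A * (dist u v * (p u * q v)) / (P * Q) := by
          simp only [γ]; ring
      _ ≤ 0 + f' u * q v / Q + p u * g' v / P + A * (K * (p u * q v)) / (P * Q) := by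
          rw [h0]; gcongr
      _ = _ := by ring
  refine (Finset.sum_le_sum fun u _ => Finset.sum_le_sum fun v _ => hcost u v).trans ?_
  simp only [Finset.sum_add_distrib, ← Finset.sum_div, ← Finset.mul_sum, ← Finset.sum_mul]
  rw [← hPdef, ← hQdef]
  apply le_of_eq
  rcases eq_or_ne Q 0 with hQz | hQz
  · have hA' : A = 0 := by linarith
    rcases eq_or_ne P 0 with hPz | hPz
    · simp [hA', hQz, hPz, hf' hQz, hg' hPz]
    · simp [hA', hQz, hf' hQz, hPz]
  · rcases eq_or_ne P 0 with hPz | hPz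
    · have hA' : A = 0 := by linarith
      simp [hA', hPz, hg' hPz, hQz]
    · field_simp

/-- Case `A ≥ 0` of the transport-plan estimate:
`W₁(μx, μy) ≤ 3 - 2μx(y) - 2μy(x) - Σ max - 2 Σ min`. -/
theorem wasserstein_upper_bound_case_A_nonneg {X : Type*} [MetricSpace X]
    (hint : ∀ u v : X, u ≠ v → ∃ n : ℕ, 0 < n ∧ dist u v = n)
    (x y : X) (hxy : dist x y = 1)
    (μx μy : X → ℝ) (hμx : IsFinProb μx) (hμy : IsFinProb μy)
    (hsx : ∀ z, μx z ≠ 0 → dist z x = 1)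
    (hsy : ∀ z, μy z ≠ 0 → dist z y = 1)
    (hA : 0 ≤ 1 - μx y - μy x -
      ∑ᶠ z, if dist z x = 1 ∧ dist z y = 1 then max (μx z) (μy z) else 0) :
    W1 (fun u v => dist u v) μx μy ≤
      3 - 2 * μx y - 2 * μy x -
        (∑ᶠ z, if dist z x = 1 ∧ dist z y = 1 then max (μx z) (μy z) else 0) -
        2 * ∑ᶠ z, if dist z x = 1 ∧ dist z y = 1 then min (μx z) (μy z) else 0 := by
  obtain ⟨hx0, hxfin, hx1⟩ := hμx
  obtain ⟨hy0, hyfin, hy1⟩ := hμy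
  set S : X → Prop := fun z => dist z x = 1 ∧ dist z y = 1 with hS
  set T : Finset X := hxfin.toFinset ∪ hyfin.toFinset ∪ {x, y} with hT
  have hxT : ∀ z ∉ T, μx z = 0 := fun z hz => by
    by_contra h
    exact hz (by simp [hT, h])
  have hyT : ∀ z ∉ T, μy z = 0 := fun z hz => by
    by_contra h
    exact hz (by simp [hT, h])
  have hxmem : x ∈ T := by simp [hT]
  have hymem : y ∈ T := by simp [hT]
  have finsum_eq : ∀ h : X → ℝ, (∀ z ∉ T, h z = 0) → ∑ᶠ z, h z = ∑ z ∈ T, h z :=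
    fun h hh => finsum_eq_sum_of_support_subset _ fun z hz => by
      by_contra hzT
      exact hz (hh z hzT)
  have hSx : ¬ S x := by simp [hS]
  have hSy : ¬ S y := by simp [hS]
  rw [finsum_eq μx hxT] at hx1
  rw [finsum_eq μy hyT] at hy1
  rw [finsum_eq (fun z => if S z then max (μx z) (μy z) else 0)
    fun z hz => by simp [hxT z hz, hyT z hz]] at hA ⊢
  rw [finsum_eq (fun z => if S z then min (μx z) (μy z) else 0)
    fun z hz => by simp [hxT z hz, hyT z hz]]
  let m : X → ℝ := fun z => if S z then min (μx z) (μy z) else 0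
  let ex : X → ℝ := fun z => if S z then μx z - min (μx z) (μy z) else 0
  let ey : X → ℝ := fun z => if S z then μy z - min (μx z) (μy z) else 0
  let a : X → ℝ := fun z => if z = y then μx y else 0
  let b : X → ℝ := fun z => if z = x then μy x else 0
  let p : X → ℝ := fun z => if z = y ∨ S z then 0 else μx z
  let q : X → ℝ := fun z => if z = x ∨ S z then 0 else μy z
  have hm : ∀ z, 0 ≤ m z := fun z => by
    simp only [m]; split_ifs <;> simp [hx0, hy0]
  have hex : ∀ z, 0 ≤ ex z := fun z => by
    simp only [ex]; split_ifs <;> simp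
  have hey : ∀ z, 0 ≤ ey z := fun z => by
    simp only [ey]; split_ifs <;> simp
  have ha : ∀ z, 0 ≤ a z := fun z => by
    simp only [a]; split_ifs <;> simp [hx0]
  have hb : ∀ z, 0 ≤ b z := fun z => by
    simp only [b]; split_ifs <;> simp [hy0]
  have hp : ∀ z, 0 ≤ p z := fun z => by
    simp only [p]; split_ifs <;> simp [hx0]
  have hq : ∀ z, 0 ≤ q z := fun z => by
    simp only [q]; split_ifs <;> simp [hy0]
  have hsplit_x : ∀ z, μx z = m z + (a z + ex z) + p z := fun z => by
    by_cases h1 : S z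
    · have : z ≠ y := fun h => hSy (h ▸ h1)
      simp [m, a, ex, p, h1, this]
    · by_cases h2 : z = y
      · simp [m, a, ex, p, h2, hSy]
      · simp [m, a, ex, p, h1, h2]
  have hsplit_y : ∀ z, μy z = m z + (b z + ey z) + q z := fun z => by
    by_cases h1 : S z
    · have : z ≠ x := fun h => hSx (h ▸ h1)
      simp [m, b, ey, q, h1, this]
    · by_cases h2 : z = x
      · simp [m, b, ey, q, h2, hSx]
      · simp [m, b, ey, q, h1, h2]
  have hmax : ∀ z, (if S z then max (μx z) (μy z) else 0) = m z + ex z + ey z := fun z => by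
    by_cases h1 : S z
    · simp only [m, ex, ey, h1, if_true]
      linarith [min_add_max (μx z) (μy z)]
    · simp [m, ex, ey, h1]
  have hsum_a : ∑ z ∈ T, a z = μx y := by simp [a, hymem]
  have hsum_b : ∑ z ∈ T, b z = μy x := by simp [b, hxmem]
  simp only [hmax, Finset.sum_add_distrib] at hA ⊢
  rw [Finset.sum_congr rfl fun z _ => hsplit_x z] at hx1
  simp only [Finset.sum_add_distrib, hsum_a] at hx1
  rw [Finset.sum_congr rfl fun z _ => hsplit_y z] at hy1
  simp only [Finset.sum_add_distrib, hsum_b] at hy1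
  have hex0 := Finset.sum_nonneg fun z (_ : z ∈ T) => hex z
  have hey0 := Finset.sum_nonneg fun z (_ : z ∈ T) => hey z
  have hp_dist : ∀ z, p z ≠ 0 → dist z x = 1 := fun z h => hsx z fun h' => h (by simp [p, h'])
  have hq_dist : ∀ z, q z ≠ 0 → dist z y = 1 := fun z h => hsy z fun h' => h (by simp [q, h'])
  have hex_dist : ∀ z, ex z ≠ 0 → dist z y = 1 := fun z h => by
    by_contra h'
    exact h (by simp [ex, hS, h'])
  have hey_dist : ∀ z, ey z ≠ 0 → dist z x = 1 := fun z h => by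
    by_contra h'
    exact h (by simp [ey, hS, h'])
  have ha_eq : ∀ z, a z ≠ 0 → z = y := fun z h => by
    by_contra h'
    exact h (by simp [a, h'])
  have hb_eq : ∀ z, b z ≠ 0 → z = x := fun z h => by
    by_contra h'
    exact h (by simp [b, h'])
  have cost : ∀ (α β : X → ℝ) (K : ℝ), (∀ z, 0 ≤ α z) → (∀ z, 0 ≤ β z) →
      (∀ u v, α u ≠ 0 → β v ≠ 0 → dist u v ≤ K) →
      ∀ u v, dist u v * (α u * β v) ≤ K * (α u * β v) := by
    intro α β K hα hβ h u v
    by_cases hu : α u = 0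
    · simp [hu]
    by_cases hv : β v = 0
    · simp [hv]
    exact mul_le_mul_of_nonneg_right (h u v hu hv) (mul_nonneg (hα u) (hβ v))
  have cost_aq := cost a q 1 ha hq fun u v hu hv => by
    rw [ha_eq u hu, dist_comm, hq_dist v hv]
  have cost_eq := cost ex q 2 hex hq fun u v hu hv => by
    linarith [dist_triangle_right u v y, hex_dist u hu, hq_dist v hv]
  have cost_pb := cost p b 1 hp hb fun u v hu hv => by
    rw [hb_eq v hv, hp_dist u hu]
  have cost_pe := cost p ey 2 hp hey fun u v hu hv => by
    linarith [dist_triangle_right u v x, hp_dist u hu, hey_dist v hv]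
  have cost_pq := cost p q 3 hp hq fun u v hu hv => by
    linarith [dist_triangle4_right u v x y, hp_dist u hu, hq_dist v hv]
  have key := W1_le_of_decomposition (μ := μx) (ν := μy) T m (fun z => a z + ex z) p
    (fun z => b z + ey z) q (fun z => a z + 2 * ex z) (fun z => b z + 2 * ey z)
    (1 - μx y - μy x - (∑ z ∈ T, m z + ∑ z ∈ T, ex z + ∑ z ∈ T, ey z)) 3
    hm (fun z => add_nonneg (ha z) (hex z)) hp (fun z => add_nonneg (hb z) (hey z)) hq hA
    (fun z hz => by simp [m, hxT z hz, hyT z hz])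
    (fun z hz => by
      have : z ≠ y := fun h => hz (h ▸ hymem)
      simp [a, ex, hxT z hz, hy0, this])
    (fun z hz => by simp [p, hxT z hz])
    (fun z hz => by
      have : z ≠ x := fun h => hz (h ▸ hxmem)
      simp [b, ey, hyT z hz, hx0, this])
    (fun z hz => by simp [q, hyT z hz])
    hsplit_x hsplit_y
    (by simp only [Finset.sum_add_distrib, hsum_b]; linarith)
    (by simp only [Finset.sum_add_distrib, hsum_a]; linarith)
    (fun u v => by linarith [cost_aq u v, cost_eq u v])
    (fun u v => by linarith [cost_pb u v, cost_pe u v])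
    cost_pq
    (fun h => by
      simp only [Finset.sum_add_distrib, hsum_a, ← Finset.mul_sum]
      linarith [hx0 y])
    (fun h => by
      simp only [Finset.sum_add_distrib, hsum_b, ← Finset.mul_sum]
      linarith [hy0 x])
  simp only [Finset.sum_add_distrib, hsum_a, hsum_b, ← Finset.mul_sum] at key
  have hm_eq : ∑ z ∈ T, (if S z then min (μx z) (μy z) else 0) = ∑ z ∈ T, m z := rfl
  rw [hm_eq]
  linarith
end

section
/- Let (X, d) be a metric space in which the distance between any two distinct points is a positive integer, and let x, y ∈ X satisfy d(x, y) = 1. Let μ_x and μ_y be finitely supported probability measures on X with μ_x supported on {z : d(z, x) = 1} and μ_y supported on {z : d(z, y) = 1}. If 1 − μ_x(y) − μ_y(x) − Σ_{z : d(z,x)=1, d(z,y)=1} min(μ_x(z), μ_y(z)) < 0, then W₁(μ_x, μ_y) ≤ 1 − Σ_{z : d(z,x)=1, d(z,y)=1} min(μ_x(z), μ_y(z)). -/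
open scoped Classical

/-- The transport cost of any finitely supported coupling bounds the Wasserstein distance, provided
the cost function is nonnegative. -/
theorem W1_le_of_coupling {X : Type*} {d : X → X → ℝ} (hd : ∀ u v, 0 ≤ d u v) {μ ν : X → ℝ}
    (γ : (X × X) →₀ ℝ) (h0 : ∀ p, 0 ≤ γ p) (h1 : ∀ u : X, (∑ᶠ v : X, γ (u, v)) = μ u)
    (h2 : ∀ v : X, (∑ᶠ u : X, γ (u, v)) = ν v) :
    W1 d μ ν ≤ ∑ᶠ p : X × X, d p.1 p.2 * γ p := by
  refine csInf_le ⟨0, ?_⟩ ⟨γ, h0, h1, h2, rfl⟩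
  rintro c ⟨γ', h0', -, -, rfl⟩
  exact finsum_nonneg fun p => mul_nonneg (hd _ _) (h0' p)

/-- The same bound for a coupling given by a function vanishing outside `s ×ˢ s`, with all sums
taken over the finite set `s`. -/
theorem W1_le_of_coupling_finset {X : Type*} {d : X → X → ℝ} (hd : ∀ u v, 0 ≤ d u v) {μ ν : X → ℝ}
    (s : Finset X) (f : X → X → ℝ) (h0 : ∀ u v, 0 ≤ f u v)
    (hf : ∀ u v, f u v ≠ 0 → u ∈ s ∧ v ∈ s)
    (h1 : ∀ u, ∑ v ∈ s, f u v = μ u) (h2 : ∀ v, ∑ u ∈ s, f u v = ν v) :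
    W1 d μ ν ≤ ∑ u ∈ s, ∑ v ∈ s, d u v * f u v := by
  have hmem : ∀ p : X × X, f p.1 p.2 ≠ 0 → p ∈ s ×ˢ s := fun p hp =>
    Finset.mem_product.2 (hf p.1 p.2 hp)
  refine (W1_le_of_coupling hd (Finsupp.onFinset (s ×ˢ s) (fun p => f p.1 p.2) hmem)
    (fun p => h0 _ _) (fun u => ?_) (fun v => ?_)).trans_eq ?_
  · rw [← h1 u]
    exact finsum_eq_sum_of_support_subset _ fun v hv => (hf u v hv).2
  · rw [← h2 v]
    exact finsum_eq_sum_of_support_subset _ fun u hu => (hf u v hu).1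
  · rw [← Finset.sum_product']
    exact finsum_eq_sum_of_support_subset _ fun p hp => hmem p (right_ne_zero_of_mul hp)

/-- Case `B < 0` of the transport-plan estimate: `W₁(μx, μy) ≤ 1 - Σ min`. -/
theorem wasserstein_upper_bound_case_B_neg {X : Type*} [MetricSpace X]
    (hint : ∀ u v : X, u ≠ v → ∃ n : ℕ, 0 < n ∧ dist u v = n)
    (x y : X) (hxy : dist x y = 1)
    (μx μy : X → ℝ) (hμx : IsFinProb μx) (hμy : IsFinProb μy)
    (hsx : ∀ z, μx z ≠ 0 → dist z x = 1)
    (hsy : ∀ z, μy z ≠ 0 → dist z y = 1)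
    (hB : 1 - μx y - μy x -
      (∑ᶠ z, if dist z x = 1 ∧ dist z y = 1 then min (μx z) (μy z) else 0) < 0) :
    W1 (fun u v => dist u v) μx μy ≤
      1 - ∑ᶠ z, if dist z x = 1 ∧ dist z y = 1 then min (μx z) (μy z) else 0 := by
  obtain ⟨hx0, hxfin, hx1⟩ := hμx
  obtain ⟨hy0, hyfin, hy1⟩ := hμy
  have hne : y ≠ x := by
    rintro rfl
    simp at hxy
  have hμxx : μx x = 0 := by
    by_contra h
    simpa using hsx x h
  have hμyy : μy y = 0 := by
    by_contra h
    simpa using hsy y h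
  have hcommon : (fun z => if dist z x = 1 ∧ dist z y = 1 then min (μx z) (μy z) else 0) =
      fun z => min (μx z) (μy z) := by
    funext z
    split_ifs with h
    · rfl
    · by_cases hz : μx z = 0
      · simp [hz, hy0 z]
      · have hz' : μy z = 0 := by
          by_contra h'
          exact h ⟨hsx z hz, hsy z h'⟩
        simp [hz', hx0 z]
  rw [hcommon] at hB ⊢
  let s : Finset X := insert x (insert y (hxfin.toFinset ∪ hyfin.toFinset))
  have hxs : x ∈ s := by simp [s]
  have hys : y ∈ s := by simp [s]
  have hxs' : ∀ z, μx z ≠ 0 → z ∈ s := fun z hz => by simp [s, hz]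
  have hys' : ∀ z, μy z ≠ 0 → z ∈ s := fun z hz => by simp [s, hz]
  have hm0 : ∀ z, 0 ≤ min (μx z) (μy z) := fun z => le_min (hx0 z) (hy0 z)
  have hmin : ∀ z, min (μx z) (μy z) ≠ 0 → z ∈ s := fun z hz =>
    hxs' z fun h => hz (by simp [h, hy0 z])
  rw [finsum_eq_sum_of_support_subset _ hxs'] at hx1
  rw [finsum_eq_sum_of_support_subset _ hys'] at hy1
  rw [finsum_eq_sum_of_support_subset _ hmin] at hB ⊢
  set m : X → ℝ := fun z => min (μx z) (μy z) with hm
  obtain ⟨α, hα⟩ : ∃ α : X → ℝ, ∀ z, α z = μx z - m z := ⟨_, fun _ => rfl⟩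
  obtain ⟨β, hβ⟩ : ∃ β : X → ℝ, ∀ z, β z = μy z - m z := ⟨_, fun _ => rfl⟩
  have hα0 : ∀ z, 0 ≤ α z := fun z => by simp [hα, hm]
  have hβ0 : ∀ z, 0 ≤ β z := fun z => by simp [hβ, hm]
  have hαμ : ∀ z, α z ≠ 0 → μx z ≠ 0 := fun z hz h => hz (by simp [hα, hm, h, hy0 z])
  have hβμ : ∀ z, β z ≠ 0 → μy z ≠ 0 := fun z hz h => hz (by simp [hβ, hm, h, hx0 z])
  have hαs : ∀ z, z ∉ s → α z = 0 := fun z hz => by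
    by_contra h
    exact hz (hxs' z (hαμ z h))
  have hβs : ∀ z, z ∉ s → β z = 0 := fun z hz => by
    by_contra h
    exact hz (hys' z (hβμ z h))
  have hms : ∀ z, z ∉ s → m z = 0 := fun z hz => by
    by_contra h
    exact hz (hmin z h)
  obtain ⟨R, hR⟩ : ∃ R : ℝ, R = 1 - ∑ z ∈ s, m z := ⟨_, rfl⟩
  have hαR : ∑ z ∈ s, α z = R := by simp only [hα, Finset.sum_sub_distrib, hx1, hR]
  have hβR : ∑ z ∈ s, β z = R := by simp only [hβ, Finset.sum_sub_distrib, hy1, hR]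
  have hαy : α y = μx y := by simp [hα, hm, hμyy, hx0 y]
  have hβx : β x = μy x := by simp [hβ, hm, hμxx, hy0 x]
  have hpos : 0 ≤ α y + β x - R := by
    rw [hαy, hβx, hR]
    linarith
  have hdα : ∀ z, dist z x * α z = α z := fun z => by
    by_cases h : α z = 0
    · simp [h]
    · rw [hsx z (hαμ z h), one_mul]
  have hdβ : ∀ z, dist y z * β z = β z := fun z => by
    by_cases h : β z = 0
    · simp [h]
    · rw [dist_comm, hsy z (hβμ z h), one_mul]
  -- Common mass stays put; all remaining mass either starts at `y` or ends at `x`.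
  let f : X → X → ℝ := fun u v =>
    (if u = v then m u else 0) + (if v = x then α u else 0) + (if u = y then β v else 0) -
      (if u = y then if v = x then R else 0 else 0)
  refine (W1_le_of_coupling_finset (fun u v => dist_nonneg) s f ?_ ?_ ?_ ?_).trans_eq ?_
  · intro u v
    have h1 := hm0 u
    have h2 := hα0 u
    have h3 := hβ0 v
    change 0 ≤ m u at h1
    by_cases h : u = y ∧ v = x
    · obtain ⟨rfl, rfl⟩ := h
      simp only [f, if_true, if_neg hne]
      linarith
    · have hR0 : (if u = y then if v = x then R else 0 else 0) = 0 := by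
        split_ifs with hu hv
        · exact absurd ⟨hu, hv⟩ h
        all_goals rfl
      simp only [f, hR0, sub_zero]
      refine add_nonneg (add_nonneg ?_ ?_) ?_ <;> split_ifs <;> first | assumption | exact le_rfl
  · intro u v huv
    by_contra h
    apply huv
    rw [not_and_or] at h
    rcases h with h | h
    · have huy : u ≠ y := fun e => h (e ▸ hys)
      simp [f, hms u h, hαs u h, huy]
    · have hvx : v ≠ x := fun e => h (e ▸ hxs)
      have hmuv : (if u = v then m u else 0) = 0 := by
        split_ifs with e
        · rw [e, hms v h]
        · rfl
      simp [f, hmuv, hβs v h, hvx]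
  · intro u
    have hmu : (if u ∈ s then m u else 0) = m u := by
      split_ifs with h
      · rfl
      · exact (hms u h).symm
    by_cases hu : u = y
    · simp only [f, hu, if_true, Finset.sum_sub_distrib, Finset.sum_add_distrib,
        Finset.sum_ite_eq, Finset.sum_ite_eq', hxs, hys, hβR, hα]
      ring
    · simp only [f, hu, if_false, Finset.sum_sub_distrib, Finset.sum_add_distrib,
        Finset.sum_ite_eq, Finset.sum_ite_eq', hxs, if_true, hmu, hα, Finset.sum_const_zero]
      ring
  · intro v
    have hmv : (if v ∈ s then m v else 0) = m v := by
      split_ifs with h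
      · rfl
      · exact (hms v h).symm
    by_cases hv : v = x
    · simp only [f, hv, if_true, Finset.sum_sub_distrib, Finset.sum_add_distrib,
        Finset.sum_ite_eq', hxs, hys, hαR, hβ]
      ring
    · simp only [f, hv, if_false, Finset.sum_sub_distrib, Finset.sum_add_distrib, ite_self,
        Finset.sum_ite_eq', hys, if_true, hmv, hβ, Finset.sum_const_zero]
      ring
  · have hcost : ∀ u ∈ s, ∑ v ∈ s, dist u v * f u v = α u := by
      intro u hu
      by_cases huy : u = y
      · subst huy
        simp only [f, if_true, mul_sub, mul_add, mul_ite, mul_zero, Finset.sum_sub_distrib,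
          Finset.sum_add_distrib, Finset.sum_ite_eq, Finset.sum_ite_eq', hxs, hu, dist_self,
          zero_mul, hdβ, hβR, dist_comm u x, hxy]
        ring
      · simp only [f, huy, if_false, mul_sub, mul_add, mul_ite, mul_zero, Finset.sum_sub_distrib,
          Finset.sum_add_distrib, Finset.sum_ite_eq, Finset.sum_ite_eq', hxs, hu, if_true,
          dist_self, zero_mul, hdα, Finset.sum_const_zero]
        ring
    rw [Finset.sum_congr rfl hcost]
    rw [hαR, hR]
end
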